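/- For every h-normal Γ-linear connection of Cartan type, the following local Bianchi identities hold for all indices l, i, j, k: (10) A_{j,k}{ (Pv^l_1j)|_(k) + P^l_j1(k) } = 0, and (11) A_{j,k}{ P^l_ji(k) + Pv^l_rj C^r_ik − (Pv^l_ik)|_(j) } = 0. -/

import Mathlib

open Finset

noncomputable section

namespace Jet

/-- Smooth real-valued functions of `(t, x, y) ∈ ℝ × ℝⁿ × ℝⁿ`, the local coordinates
of the 1-jet space `J¹(ℝ, M)`. -/
abbrev Fn (n : ℕ) : Type := ℝ → (Fin n → ℝ) → (Fin n → ℝ) → ℝ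

def Smooth {n : ℕ} (F : Fn n) : Prop :=
  ContDiff ℝ (⊤ : ℕ∞) (fun p : ℝ × (Fin n → ℝ) × (Fin n → ℝ) => F p.1 p.2.1 p.2.2)

/-- Partial derivative in the time variable `t`. -/
def pt {n : ℕ} (F : Fn n) : Fn n := fun t x y => deriv (fun s => F s x y) t

/-- Partial derivative in the spatial variable `xⁱ`. -/
def px {n : ℕ} (i : Fin n) (F : Fn n) : Fn n :=
  fun t x y => deriv (fun s => F t (Function.update x i s) y) (x i)

/-- Partial derivative in the fibre variable `yⁱ`. -/
def py {n : ℕ} (i : Fin n) (F : Fn n) : Fn n :=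
  fun t x y => deriv (fun s => F t x (Function.update y i s)) (y i)

/-- Kronecker delta, as a constant function on the jet space. -/
def kron {n : ℕ} (i j : Fin n) : Fn n := if i = j then 1 else 0

/-- The coordinate function `yⁱ`. -/
def yc {n : ℕ} (i : Fin n) : Fn n := fun _ _ y => y i

/-- The Christoffel symbol `κ(t) = (1/(2h)) dh/dt` of a Riemannian metric `h` on `ℝ`,
as a function on the jet space. -/
def chr {n : ℕ} (h : ℝ → ℝ) : Fn n := fun t _ _ => deriv h t / (2 * h t)

/-- The metric `h(t)` as a function on the jet space. -/
def hfun {n : ℕ} (h : ℝ → ℝ) : Fn n := fun t _ _ => h t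

/-- The derivative `dh/dt` as a function on the jet space. -/
def hder {n : ℕ} (h : ℝ → ℝ) : Fn n := fun t _ _ => deriv h t

variable {n : ℕ}

/-- The adapted temporal derivative `δ/δt = ∂/∂t − Mʳ ∂/∂yʳ` determined by a
nonlinear connection `(M, N)`. -/
def dt (M : Fin n → Fn n) (F : Fn n) : Fn n := pt F - ∑ r, M r * py r F

/-- The adapted spatial derivative `δ/δxᵏ = ∂/∂xᵏ − Nʳₖ ∂/∂yʳ`. -/
def dx (N : Fin n → Fin n → Fn n) (k : Fin n) (F : Fn n) : Fn n :=
  px k F - ∑ r, N r k * py r F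

/-- An `h`-normal `Γ`-linear connection `(κ, Gᵏᵢ, Lᵏᵢⱼ, Cᵏᵢⱼ)`. -/
structure Conn (n : ℕ) where
  κ : Fn n
  G : Fin n → Fin n → Fn n
  L : Fin n → Fin n → Fin n → Fn n
  C : Fin n → Fin n → Fin n → Fn n

/-! ### Torsion d-tensors -/

/-- `Tʳ₁ⱼ = −Gʳⱼ`. -/
def T1 (Γ : Conn n) (r j : Fin n) : Fn n := -Γ.G r j

/-- `Rvʳ₁ⱼ = (δ/δxʲ)Mʳ − (δ/δt)Nʳⱼ`. -/
def Rv1 (M : Fin n → Fn n) (N : Fin n → Fin n → Fn n) (r j : Fin n) : Fn n :=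
  dx N j (M r) - dt M (N r j)

/-- `Tʳᵢⱼ = Lʳᵢⱼ − Lʳⱼᵢ`. -/
def Tsp (Γ : Conn n) (r i j : Fin n) : Fn n := Γ.L r i j - Γ.L r j i

/-- `Rvʳᵢⱼ = (δ/δxʲ)Nʳᵢ − (δ/δxⁱ)Nʳⱼ`. -/
def Rvsp (M : Fin n → Fn n) (N : Fin n → Fin n → Fn n) (r i j : Fin n) : Fn n :=
  dx N j (N r i) - dx N i (N r j)

/-- `Pvʳ₁ⱼ = ∂Mʳ/∂yʲ − Gʳⱼ + δʳⱼ κ`. -/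
def Pv1 (M : Fin n → Fn n) (Γ : Conn n) (r j : Fin n) : Fn n :=
  py j (M r) - Γ.G r j + kron r j * Γ.κ

/-- `Phʳᵢⱼ = Cʳᵢⱼ`. -/
def Phsp (Γ : Conn n) (r i j : Fin n) : Fn n := Γ.C r i j

/-- `Pvʳᵢⱼ = ∂Nʳᵢ/∂yʲ − Lʳⱼᵢ`. -/
def Pvsp (N : Fin n → Fin n → Fn n) (Γ : Conn n) (r i j : Fin n) : Fn n :=
  py j (N r i) - Γ.L r j i

/-- `Sʳᵢⱼ = Cʳᵢⱼ − Cʳⱼᵢ`. -/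
def Ssp (Γ : Conn n) (r i j : Fin n) : Fn n := Γ.C r i j - Γ.C r j i

/-! ### Generic covariant derivatives of d-tensors -/

/-- Index types of the (valued) indices of a d-tensor: upper/lower spatial,
upper/lower vertical.  (Temporal indices carry no value; they are accounted for by the
temporal weight `p` = number of upper temporal indices minus number of lower temporal
indices.) -/
inductive IdxType | uS | lS | uV | lV

/-- A d-tensor component family with `m` valued indices. -/
abbrev Tensor (n m : ℕ) := (Fin m → Fin n) → Fn n

/-- The `ℝ`-horizontal covariant derivative `D_{/1}` of a d-tensor `D` with valued index
signature `σ` and temporal weight `p`. -/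
def covT {m : ℕ} (M : Fin n → Fn n) (Γ : Conn n) (p : ℤ) (σ : Fin m → IdxType)
    (D : Tensor n m) : Tensor n m := fun a =>
  dt M (D a) + p • (Γ.κ * D a)
    + ∑ q : Fin m,
      (match σ q with
      | .uS => ∑ r, D (Function.update a q r) * Γ.G (a q) r
      | .lS => -∑ r, D (Function.update a q r) * Γ.G r (a q)
      | .uV => ∑ r, D (Function.update a q r) * (Γ.G (a q) r - kron (a q) r * Γ.κ)
      | .lV => -∑ r, D (Function.update a q r) * (Γ.G r (a q) - kron r (a q) * Γ.κ) : Fn n)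

/-- The `M`-horizontal covariant derivative `D_{|k}`. -/
def covX {m : ℕ} (N : Fin n → Fin n → Fn n) (Γ : Conn n) (σ : Fin m → IdxType)
    (k : Fin n) (D : Tensor n m) : Tensor n m := fun a =>
  dx N k (D a)
    + ∑ q : Fin m,
      (match σ q with
      | .uS => ∑ r, D (Function.update a q r) * Γ.L (a q) r k
      | .uV => ∑ r, D (Function.update a q r) * Γ.L (a q) r k
      | .lS => -∑ r, D (Function.update a q r) * Γ.L r (a q) k
      | .lV => -∑ r, D (Function.update a q r) * Γ.L r (a q) k : Fn n)

/-- The vertical covariant derivative `D|_{(k)}`. -/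
def covY {m : ℕ} (Γ : Conn n) (σ : Fin m → IdxType)
    (k : Fin n) (D : Tensor n m) : Tensor n m := fun a =>
  py k (D a)
    + ∑ q : Fin m,
      (match σ q with
      | .uS => ∑ r, D (Function.update a q r) * Γ.C (a q) r k
      | .uV => ∑ r, D (Function.update a q r) * Γ.C (a q) r k
      | .lS => -∑ r, D (Function.update a q r) * Γ.C r (a q) k
      | .lV => -∑ r, D (Function.update a q r) * Γ.C r (a q) k : Fn n)

/-- The coefficients `Cᵏᵢⱼ` viewed as a d-tensor with signature
(upper spatial, lower spatial, lower vertical). -/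
def CT (Γ : Conn n) : Tensor n 3 := fun a => Γ.C (a 0) (a 1) (a 2)

/-- The signature of `Cᵏᵢⱼ`. -/
def sigC : Fin 3 → IdxType := ![IdxType.uS, IdxType.lS, IdxType.lV]

/-! ### Curvature d-tensors -/

/-- `Rˡᵢ₁ₖ`. -/
def Rc1 (M : Fin n → Fn n) (N : Fin n → Fin n → Fn n) (Γ : Conn n) (l i k : Fin n) : Fn n :=
  dx N k (Γ.G l i) - dt M (Γ.L l i k) + ∑ r, Γ.G r i * Γ.L l r k
    - ∑ r, Γ.L r i k * Γ.G l r + ∑ r, Γ.C l i r * Rv1 M N r k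

/-- `Rˡᵢⱼₖ`. -/
def Rc (M : Fin n → Fn n) (N : Fin n → Fin n → Fn n) (Γ : Conn n) (l i j k : Fin n) : Fn n :=
  dx N k (Γ.L l i j) - dx N j (Γ.L l i k) + ∑ r, Γ.L r i j * Γ.L l r k
    - ∑ r, Γ.L r i k * Γ.L l r j + ∑ r, Γ.C l i r * Rvsp M N r j k

/-- `Pˡᵢ₁₍ₖ₎`. -/
def Pc1 (M : Fin n → Fn n) (N : Fin n → Fin n → Fn n) (Γ : Conn n) (l i k : Fin n) : Fn n :=
  py k (Γ.G l i) - covT M Γ 0 sigC (CT Γ) ![l, i, k] + ∑ r, Γ.C l i r * Pv1 M Γ r k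

/-- `Pˡᵢⱼ₍ₖ₎`. -/
def Pc (M : Fin n → Fn n) (N : Fin n → Fin n → Fn n) (Γ : Conn n) (l i j k : Fin n) : Fn n :=
  py k (Γ.L l i j) - covX N Γ sigC j (CT Γ) ![l, i, k] + ∑ r, Γ.C l i r * Pvsp N Γ r j k

/-- `Sˡᵢ₍ⱼ₎₍ₖ₎`. -/
def Sc (Γ : Conn n) (l i j k : Fin n) : Fn n :=
  py k (Γ.C l i j) - py j (Γ.C l i k)
    + ∑ r, Γ.C r i j * Γ.C l r k - ∑ r, Γ.C r i k * Γ.C l r j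

end Jet

namespace Jet

variable {n : ℕ}

/-- A family with one valued index, viewed as a d-tensor. -/
def famT (X : Fin n → Fn n) : Tensor n 1 := fun a => X (a 0)

def T1T (Γ : Conn n) : Tensor n 2 := fun a => T1 Γ (a 0) (a 1)
def Rv1T (M : Fin n → Fn n) (N : Fin n → Fin n → Fn n) : Tensor n 2 :=
  fun a => Rv1 M N (a 0) (a 1)
def RvspT (M : Fin n → Fn n) (N : Fin n → Fin n → Fn n) : Tensor n 3 :=
  fun a => Rvsp M N (a 0) (a 1) (a 2)
def Pv1T (M : Fin n → Fn n) (Γ : Conn n) : Tensor n 2 := fun a => Pv1 M Γ (a 0) (a 1)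
def PvspT (N : Fin n → Fin n → Fn n) (Γ : Conn n) : Tensor n 3 :=
  fun a => Pvsp N Γ (a 0) (a 1) (a 2)
def Rc1T (M : Fin n → Fn n) (N : Fin n → Fin n → Fn n) (Γ : Conn n) : Tensor n 3 :=
  fun a => Rc1 M N Γ (a 0) (a 1) (a 2)
def RcT (M : Fin n → Fn n) (N : Fin n → Fin n → Fn n) (Γ : Conn n) : Tensor n 4 :=
  fun a => Rc M N Γ (a 0) (a 1) (a 2) (a 3)
def Pc1T (M : Fin n → Fn n) (N : Fin n → Fin n → Fn n) (Γ : Conn n) : Tensor n 3 :=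
  fun a => Pc1 M N Γ (a 0) (a 1) (a 2)
def PcT (M : Fin n → Fn n) (N : Fin n → Fin n → Fn n) (Γ : Conn n) : Tensor n 4 :=
  fun a => Pc M N Γ (a 0) (a 1) (a 2) (a 3)
def ScT (Γ : Conn n) : Tensor n 4 := fun a => Sc Γ (a 0) (a 1) (a 2) (a 3)

/-- valued-index signatures (temporal indices are tracked by the weight `p` only) -/
def sig0 : Fin 0 → IdxType := ![]
def siglS : Fin 1 → IdxType := ![IdxType.lS]
def siglV : Fin 1 → IdxType := ![IdxType.lV]
def sigU : Fin 1 → IdxType := ![IdxType.uS]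
def sigV : Fin 1 → IdxType := ![IdxType.uV]
def sigUlS : Fin 2 → IdxType := ![IdxType.uS, IdxType.lS]
def sigUlV : Fin 2 → IdxType := ![IdxType.uS, IdxType.lV]
def sigVlS : Fin 2 → IdxType := ![IdxType.uV, IdxType.lS]
def sigVlV : Fin 2 → IdxType := ![IdxType.uV, IdxType.lV]
def sigRvsp : Fin 3 → IdxType := ![IdxType.uV, IdxType.lS, IdxType.lS]
def sigPvsp : Fin 3 → IdxType := ![IdxType.uV, IdxType.lS, IdxType.lV]
def sigRc1 : Fin 3 → IdxType := ![IdxType.uS, IdxType.lS, IdxType.lS]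
def sigRc : Fin 4 → IdxType := ![IdxType.uS, IdxType.lS, IdxType.lS, IdxType.lS]
def sigPc1 : Fin 3 → IdxType := ![IdxType.uS, IdxType.lS, IdxType.lV]
def sigPc : Fin 4 → IdxType := ![IdxType.uS, IdxType.lS, IdxType.lS, IdxType.lV]
def sigSc : Fin 4 → IdxType := ![IdxType.uS, IdxType.lS, IdxType.lV, IdxType.lV]

end Jet

namespace Jet

/-- A smooth function, uncurried. -/
def uncurried (F : Fn n) (p : ℝ × (Fin n → ℝ) × (Fin n → ℝ)) : ℝ := F p.1 p.2.1 p.2.2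

theorem Smooth.hasDerivAt_py {F : Fn n} (hF : Smooth F) (i : Fin n) (t : ℝ) (x y : Fin n → ℝ) :
    HasDerivAt (fun s => F t x (Function.update y i s))
      (fderiv ℝ (uncurried F) (t, x, y) (0, 0, Pi.single i 1)) (y i) := by
  have hd : Differentiable ℝ (uncurried F) := ContDiff.differentiable hF (by simp)
  have hcurve : HasDerivAt (fun s => (t, x, Function.update y i s))
      ((0 : ℝ), (0 : Fin n → ℝ), Pi.single i (1 : ℝ)) (y i) :=
    (hasDerivAt_const _ _).prodMk ((hasDerivAt_const _ _).prodMk (hasDerivAt_update y i (y i)))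
  have hF' := (hd (t, x, Function.update y i (y i))).hasFDerivAt.comp_hasDerivAt (y i) hcurve
  rw [Function.update_eq_self] at hF'
  exact hF'

theorem Smooth.py_apply {F : Fn n} (hF : Smooth F) (i : Fin n) (t : ℝ) (x y : Fin n → ℝ) :
    py i F t x y = fderiv ℝ (uncurried F) (t, x, y) (0, 0, Pi.single i 1) :=
  (hF.hasDerivAt_py i t x y).deriv

theorem Smooth.uncurried_py {F : Fn n} (hF : Smooth F) (i : Fin n) :
    uncurried (py i F) = fun p => fderiv ℝ (uncurried F) p (0, 0, Pi.single i 1) :=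
  funext fun p => hF.py_apply i p.1 p.2.1 p.2.2

theorem Smooth.py {F : Fn n} (hF : Smooth F) (i : Fin n) : Smooth (py i F) := by
  change ContDiff ℝ _ (uncurried (Jet.py i F))
  rw [hF.uncurried_py i]
  have hF' : ContDiff ℝ (⊤ : ℕ∞) (fderiv ℝ (uncurried F)) :=
    ContDiff.fderiv_right hF (by simp)
  exact hF'.clm_apply contDiff_const

theorem py_py_apply {F : Fn n} (hF : Smooth F) (i j : Fin n) (t : ℝ) (x y : Fin n → ℝ) :
    py i (py j F) t x y = fderiv ℝ (fderiv ℝ (uncurried F)) (t, x, y)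
      (0, 0, Pi.single i 1) (0, 0, Pi.single j 1) := by
  have hF' : Differentiable ℝ (fderiv ℝ (uncurried F)) :=
    (ContDiff.fderiv_right (m := 1) hF (by norm_cast)).differentiable (by simp)
  rw [(hF.py j).py_apply, hF.uncurried_py j, fderiv_clm_apply (hF' _) (by fun_prop)]
  simp

theorem py_comm {F : Fn n} (hF : Smooth F) (i j : Fin n) : py i (py j F) = py j (py i F) := by
  funext t x y
  rw [py_py_apply hF, py_py_apply hF]
  refine ContDiffAt.isSymmSndFDerivAt (n := (⊤ : ℕ∞)) (ContDiff.contDiffAt hF) ?_ _ _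
  rw [minSmoothness_of_isRCLikeNormedField]
  norm_cast

theorem py_sub {F H : Fn n} (hF : Smooth F) (hH : Smooth H) (i : Fin n) :
    py i (F - H) = py i F - py i H := by
  funext t x y
  have hd := ((hF.hasDerivAt_py i t x y).sub (hH.hasDerivAt_py i t x y)).deriv
  rw [← hF.py_apply, ← hH.py_apply] at hd
  exact hd

/-- Adding a function of time alone does not change fibre derivatives. -/
theorem py_add_kron_mul_chr (F : Fn n) (h : ℝ → ℝ) (i r j : Fin n) :
    py i (F + kron r j * chr h) = py i F := by
  have hk : ∀ (t : ℝ) (x y y' : Fin n → ℝ), (kron r j : Fn n) t x y = (kron r j : Fn n) t x y' := by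
    intro t x y y'
    unfold kron
    split_ifs <;> rfl
  funext t x y
  simp only [py, Pi.add_apply, Pi.mul_apply, chr]
  simp only [hk t x _ y]
  exact deriv_add_const _

theorem covY_Pv1T (M : Fin n → Fn n) (Γ : Conn n) (l j k : Fin n) :
    covY Γ sigVlV k (Pv1T M Γ) ![l, j] = py k (Pv1 M Γ l j)
      + (∑ r, Pv1 M Γ r j * Γ.C l r k - ∑ r, Pv1 M Γ l r * Γ.C r j k) := by
  simp [covY, sigVlV, Pv1T, Fin.sum_univ_two, sub_eq_add_neg]

theorem covY_PvspT (N : Fin n → Fin n → Fn n) (Γ : Conn n) (l i j k : Fin n) :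
    covY Γ sigPvsp k (PvspT N Γ) ![l, i, j] = py k (Pvsp N Γ l i j)
      + (∑ r, Pvsp N Γ r i j * Γ.C l r k - ∑ r, Pvsp N Γ l r j * Γ.C r i k
        - ∑ r, Pvsp N Γ l i r * Γ.C r j k) := by
  simp [covY, sigPvsp, PvspT, Fin.sum_univ_three, sub_eq_add_neg]

theorem covT_CT (M : Fin n → Fn n) (Γ : Conn n) (l i k : Fin n) :
    covT M Γ 0 sigC (CT Γ) ![l, i, k] = dt M (Γ.C l i k)
      + (∑ r, Γ.C r i k * Γ.G l r - ∑ r, Γ.C l r k * Γ.G r i - ∑ r, Γ.C l i r * Γ.G r k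
        + Γ.C l i k * Γ.κ) := by
  have hk : ∑ r, Γ.C l i r * (kron r k * Γ.κ) = Γ.C l i k * Γ.κ := by
    simp [kron]
  simp [covT, sigC, CT, Fin.sum_univ_three, mul_sub, sum_sub_distrib, hk]
  ring

theorem covX_CT (N : Fin n → Fin n → Fn n) (Γ : Conn n) (l i j k : Fin n) :
    covX N Γ sigC j (CT Γ) ![l, i, k] = dx N j (Γ.C l i k)
      + (∑ r, Γ.C r i k * Γ.L l r j - ∑ r, Γ.C l r k * Γ.L r i j
        - ∑ r, Γ.C l i r * Γ.L r k j) := by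
  simp [covX, sigC, CT, Fin.sum_univ_three, sub_eq_add_neg]

/-- For symmetric `C`, the temporal covariant derivative of `C` is symmetric. -/
theorem covT_CT_symm (M : Fin n → Fn n) (Γ : Conn n)
    (hCsym : ∀ k i j, Γ.C k i j = Γ.C k j i) (l i k : Fin n) :
    covT M Γ 0 sigC (CT Γ) ![l, i, k] = covT M Γ 0 sigC (CT Γ) ![l, k, i] := by
  rw [covT_CT, covT_CT]
  simp only [hCsym _ k, hCsym l _ i]
  ring

/-- For symmetric `C`, the spatial covariant derivative of `C` is symmetric. -/
theorem covX_CT_symm (N : Fin n → Fin n → Fn n) (Γ : Conn n)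
    (hCsym : ∀ k i j, Γ.C k i j = Γ.C k j i) (l i j k : Fin n) :
    covX N Γ sigC j (CT Γ) ![l, i, k] = covX N Γ sigC j (CT Γ) ![l, k, i] := by
  rw [covX_CT, covX_CT]
  simp only [hCsym _ k, hCsym l _ i]
  ring

theorem py_Pv1 {h : ℝ → ℝ} {M : Fin n → Fn n} {Γ : Conn n} (hκ : Γ.κ = chr h)
    (hMs : ∀ i, Smooth (M i)) (hGs : ∀ k i, Smooth (Γ.G k i)) (l j k : Fin n) :
    py k (Pv1 M Γ l j) = py k (py j (M l)) - py k (Γ.G l j) := by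
  rw [Pv1, hκ, py_add_kron_mul_chr, py_sub ((hMs l).py j) (hGs l j)]

theorem py_Pvsp {N : Fin n → Fin n → Fn n} {Γ : Conn n}
    (hNs : ∀ i j, Smooth (N i j)) (hLs : ∀ k i j, Smooth (Γ.L k i j)) (l i j k : Fin n) :
    py k (Pvsp N Γ l i j) = py k (py j (N l i)) - py k (Γ.L l j i) := by
  rw [Pvsp, py_sub ((hNs l i).py j) (hLs l j i)]

/-- local Bianchi identities for an h-normal Γ-linear connection
of Cartan type. -/
theorem bianchi_identities_10_11
    (n : ℕ) (hn : 1 ≤ n)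
    (h : ℝ → ℝ) (hh : ContDiff ℝ (⊤ : ℕ∞) h) (hhpos : ∀ t, 0 < h t)
    (M : Fin n → Fn n) (N : Fin n → Fin n → Fn n) (Γ : Conn n)
    (hκ : Γ.κ = chr h)
    (hMs : ∀ i, Smooth (M i)) (hNs : ∀ i j, Smooth (N i j))
    (hGs : ∀ k i, Smooth (Γ.G k i)) (hLs : ∀ k i j, Smooth (Γ.L k i j))
    (hCs : ∀ k i j, Smooth (Γ.C k i j))
    (hLsym : ∀ k i j, Γ.L k i j = Γ.L k j i) (hCsym : ∀ k i j, Γ.C k i j = Γ.C k j i) :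
    (∀ l j k,
      ((covY Γ sigVlV k (Pv1T M Γ) ![l, j] + Pc1 M N Γ l j k)
        - (covY Γ sigVlV j (Pv1T M Γ) ![l, k] + Pc1 M N Γ l k j)) = 0)
    ∧ (∀ l i j k,
      ((Pc M N Γ l j i k + (∑ r, Pvsp N Γ l r j * Γ.C r i k)
          - covY Γ sigPvsp j (PvspT N Γ) ![l, i, k])
        - (Pc M N Γ l k i j + (∑ r, Pvsp N Γ l r k * Γ.C r i j)
          - covY Γ sigPvsp k (PvspT N Γ) ![l, i, j])) = 0) := by
  constructor
  · intro l j k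
    rw [covY_Pv1T, covY_Pv1T, Pc1, Pc1, py_Pv1 hκ hMs hGs, py_Pv1 hκ hMs hGs,
      py_comm (hMs l) k j, covT_CT_symm M Γ hCsym l j k]
    have hP : ∀ a b, ∑ r, Pv1 M Γ r a * Γ.C l r b = ∑ r, Γ.C l b r * Pv1 M Γ r a := fun a b =>
      sum_congr rfl fun r _ => by rw [hCsym l r b, mul_comm]
    rw [hP, hP]
    simp only [hCsym _ k j]
    ring
  · intro l i j k
    rw [covY_PvspT, covY_PvspT, Pc, Pc, py_Pvsp hNs hLs, py_Pvsp hNs hLs,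
      py_comm (hNs l i) k j, covX_CT_symm N Γ hCsym l j i k]
    have hP : ∀ a b, ∑ r, Pvsp N Γ r i a * Γ.C l r b = ∑ r, Γ.C l b r * Pvsp N Γ r i a :=
      fun a b => sum_congr rfl fun r _ => by rw [hCsym l r b, mul_comm]
    rw [hP, hP]
    simp only [hCsym _ k j]
    ring

end Jet
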